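/- The first eigenvalue of the mixed operator with mixed boundary conditions is positive; precisely, the infimum of the Rayleigh quotient ( ∫_Ω |∇u(x)|² dx + ∬_Q |u(x) − u(y)|² / |x − y|^{n+2s} dx dy ) / ∫_Ω |u(x)|² dx, taken over all continuously differentiable functions u : ℝⁿ → ℝ with compact support contained in U and with ∫_Ω |u(x)|² dx ≠ 0, is strictly positive. -/

import Mathlib

open MeasureTheory

noncomputable def kerProfile (n : ℕ) (s : ℝ) (r : ℝ) : ℝ :=
  if r ≤ 1 then r ^ (2 - ((n : ℝ) + 2 * s)) else r ^ (-((n : ℝ) + 2 * s))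

lemma kerProfile_nonneg (n : ℕ) (s : ℝ) {r : ℝ} (hr : 0 ≤ r) : 0 ≤ kerProfile n s r := by
  unfold kerProfile
  split_ifs <;> positivity

lemma kerProfile_integrable (n : ℕ) (hn : 1 ≤ n) (s : ℝ) (hs : s ∈ Set.Ioo (0 : ℝ) 1) :
    Integrable (fun z : EuclideanSpace ℝ (Fin n) => kerProfile n s ‖z‖) := by
  haveI : Nonempty (Fin n) := ⟨⟨0, hn⟩⟩
  have h0 := hs.1
  have h1 := hs.2
  rw [integrable_fun_norm_addHaar (μ := volume)]
  rw [finrank_euclideanSpace, Fintype.card_fin]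
  rw [← Set.Ioc_union_Ioi_eq_Ioi (zero_le_one : (0 : ℝ) ≤ 1)]
  refine IntegrableOn.union ?_ ?_
  · have h : IntegrableOn (fun y : ℝ => y ^ (1 - 2 * s)) (Set.Ioc 0 1) := by
      rw [← intervalIntegrable_iff_integrableOn_Ioc_of_le zero_le_one]
      exact intervalIntegral.intervalIntegrable_rpow' (by linarith)
    refine h.congr_fun ?_ measurableSet_Ioc
    intro y hy
    have hy0 : 0 < y := hy.1
    simp only [kerProfile, if_pos hy.2, smul_eq_mul]
    rw [← Real.rpow_natCast y (n - 1), ← Real.rpow_add hy0, Nat.cast_sub hn]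
    congr 1
    push_cast
    ring
  · have h : IntegrableOn (fun y : ℝ => y ^ (-1 - 2 * s)) (Set.Ioi 1) :=
      integrableOn_Ioi_rpow_of_lt (by linarith) one_pos
    refine h.congr_fun ?_ measurableSet_Ioi
    intro y hy
    have hy0 : 0 < y := lt_trans one_pos hy
    simp only [kerProfile, if_neg (not_le.mpr (Set.mem_Ioi.mp hy)), smul_eq_mul]
    rw [← Real.rpow_natCast y (n - 1), ← Real.rpow_add hy0, Nat.cast_sub hn]
    congr 1
    push_cast
    ring

lemma quot_le (n : ℕ) (s : ℝ) (hs : s ∈ Set.Ioo (0 : ℝ) 1) (u : EuclideanSpace ℝ (Fin n) → ℝ)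
    (K M : ℝ) (hK : ∀ x y, |u x - u y| ≤ K * ‖x - y‖) (hM : ∀ x, |u x| ≤ M)
    (x y : EuclideanSpace ℝ (Fin n)) :
    (u x - u y) ^ 2 / ‖x - y‖ ^ ((n : ℝ) + 2 * s)
      ≤ (K ^ 2 + (2 * M) ^ 2) * kerProfile n s ‖x - y‖ := by
  rcases eq_or_ne x y with rfl | hxy
  · simp only [sub_self, ne_eq, OfNat.ofNat_ne_zero, not_false_eq_true, zero_pow, zero_div]
    exact mul_nonneg (by positivity) (kerProfile_nonneg n s (norm_nonneg _))
  have hr : 0 < ‖x - y‖ := norm_pos_iff.mpr (sub_ne_zero.mpr hxy)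
  have hk := hK x y
  have hm : |u x - u y| ≤ 2 * M := by
    have := abs_sub (u x) (u y)
    linarith [hM x, hM y]
  generalize ‖x - y‖ = r at *
  generalize u x - u y = d at *
  have hk2 : d ^ 2 ≤ K ^ 2 * r ^ 2 := by
    rw [← mul_pow, ← sq_abs d]; gcongr
  have hm2 : d ^ 2 ≤ (2 * M) ^ 2 := by
    rw [← sq_abs d]; gcongr
  unfold kerProfile
  split_ifs with h
  · rw [Real.rpow_sub hr, ← mul_div_assoc]
    gcongr
    rw [Real.rpow_two]
    nlinarith [mul_nonneg (sq_nonneg (2 * M)) (sq_nonneg r)]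
  · rw [Real.rpow_neg hr.le, ← div_eq_mul_inv]
    gcongr
    nlinarith [sq_nonneg K]

lemma energy_integrable (n : ℕ) (hn : 1 ≤ n) (s : ℝ) (hs : s ∈ Set.Ioo (0 : ℝ) 1)
    (Ω : Set (EuclideanSpace ℝ (Fin n))) (hΩopen : IsOpen Ω) (hΩbdd : Bornology.IsBounded Ω)
    (u : EuclideanSpace ℝ (Fin n) → ℝ) (hu : ContDiff ℝ 1 u) (hc : HasCompactSupport u) :
    IntegrableOn (fun p : EuclideanSpace ℝ (Fin n) × EuclideanSpace ℝ (Fin n) =>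
      (u p.1 - u p.2) ^ 2 / ‖p.1 - p.2‖ ^ ((n : ℝ) + 2 * s)) (Ωᶜ ×ˢ Ωᶜ)ᶜ := by
  obtain ⟨K, hK⟩ := hu.lipschitzWith_of_hasCompactSupport hc one_ne_zero
  obtain ⟨M, hM⟩ := hc.exists_bound_of_continuous hu.continuous
  have hK' : ∀ x y, |u x - u y| ≤ K * ‖x - y‖ := by
    intro x y
    have := hK.dist_le_mul x y
    rwa [Real.dist_eq, dist_eq_norm] at this
  have hcont := hu.continuous
  have hmeas : Measurable (fun p : EuclideanSpace ℝ (Fin n) × EuclideanSpace ℝ (Fin n) =>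
      (u p.1 - u p.2) ^ 2 / ‖p.1 - p.2‖ ^ ((n : ℝ) + 2 * s)) := by
    have := hcont.measurable
    fun_prop
  have hind : Integrable (Ω.indicator (fun _ => (1 : ℝ))) :=
    (integrable_indicator_iff hΩopen.measurableSet).mpr
      (integrableOn_const hΩbdd.measure_lt_top.ne)
  have hconv := (hind.convolution_integrand (ContinuousLinearMap.mul ℝ ℝ)
    ((kerProfile_integrable n hn s hs).const_mul ((K : ℝ) ^ 2 + (2 * M) ^ 2)))
  have hright : IntegrableOn (fun p : EuclideanSpace ℝ (Fin n) × EuclideanSpace ℝ (Fin n) =>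
      (u p.1 - u p.2) ^ 2 / ‖p.1 - p.2‖ ^ ((n : ℝ) + 2 * s)) (Set.univ ×ˢ Ω) := by
    rw [← integrable_indicator_iff (MeasurableSet.univ.prod hΩopen.measurableSet)]
    refine Integrable.mono' hconv
      (hmeas.indicator (MeasurableSet.univ.prod hΩopen.measurableSet)).aestronglyMeasurable ?_
    refine Filter.Eventually.of_forall fun p => ?_
    by_cases hp : p.2 ∈ Ω
    · have hp' : p ∈ (Set.univ ×ˢ Ω : Set (EuclideanSpace ℝ (Fin n) × _)) := ⟨trivial, hp⟩
      rw [Set.indicator_of_mem hp', Set.indicator_of_mem hp, Real.norm_of_nonneg (by positivity)]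
      simpa using quot_le n s hs u K M hK' hM p.1 p.2
    · have hp' : p ∉ (Set.univ ×ˢ Ω : Set (EuclideanSpace ℝ (Fin n) × _)) := fun h => hp h.2
      rw [Set.indicator_of_notMem hp', Set.indicator_of_notMem hp]
      simp
  have hleft : IntegrableOn (fun p : EuclideanSpace ℝ (Fin n) × EuclideanSpace ℝ (Fin n) =>
      (u p.1 - u p.2) ^ 2 / ‖p.1 - p.2‖ ^ ((n : ℝ) + 2 * s)) (Ω ×ˢ Set.univ) := by
    rw [IntegrableOn, Measure.volume_eq_prod, ← Measure.prod_restrict] at hright ⊢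
    have := hright.swap
    refine this.congr (Filter.Eventually.of_forall fun p => ?_)
    simp only [Function.comp, Prod.fst_swap, Prod.snd_swap]
    rw [norm_sub_rev, ← neg_sub (u p.1), neg_sq]
  refine (hleft.union hright).mono_set ?_
  intro p hp
  by_contra h
  apply hp
  simp only [Set.mem_union, Set.mem_prod, Set.mem_univ, and_true, true_and, not_or] at h
  exact ⟨h.1, h.2⟩

lemma exists_test (n : ℕ) (Ω : Set (EuclideanSpace ℝ (Fin n)))
    (hΩne : Ω.Nonempty) (hΩopen : IsOpen Ω) :
    ∃ u : EuclideanSpace ℝ (Fin n) → ℝ, ContDiff ℝ 1 u ∧ HasCompactSupport u ∧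
      tsupport u ⊆ Ω ∧ (∫ x in Ω, (u x) ^ 2) ≠ 0 := by
  obtain ⟨x, hx⟩ := hΩne
  obtain ⟨u, h1, h2, h3, -, h5⟩ := exists_contDiff_tsupport_subset (n := 1) (hΩopen.mem_nhds hx)
  refine ⟨u, h3, h2, h1, ?_⟩
  have hcont := h3.continuous
  have hsup : HasCompactSupport (fun x => u x ^ 2) :=
    h2.comp_left (g := fun t : ℝ => t ^ 2) (by simp)
  rw [setIntegral_eq_integral_of_forall_compl_eq_zero]
  · refine ne_of_gt ?_
    refine Continuous.integral_pos_of_hasCompactSupport_nonneg_nonzero (x := x)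
      (by fun_prop) hsup (fun y => sq_nonneg _) (by simp [h5])
  · intro y hy
    have : y ∉ tsupport u := fun h => hy (h1 h)
    simp [image_eq_zero_of_notMem_tsupport this]

/-- The first eigenvalue of the mixed operator with mixed boundary conditions is positive:
the infimum of the Rayleigh quotient over all `C¹` functions with compact support contained
in `U = Ω ∪ 𝒩 ∪ (∂Ω ∩ closure 𝒩)` and nonzero `L²(Ω)`-mass is strictly positive. -/
theorem first_eigenvalue_positive (n : ℕ) (hn : 1 ≤ n) (s : ℝ) (hs : s ∈ Set.Ioo (0 : ℝ) 1)
    (Ω 𝒩 : Set (EuclideanSpace ℝ (Fin n)))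
    (hΩne : Ω.Nonempty) (hΩopen : IsOpen Ω) (hΩbdd : Bornology.IsBounded Ω)
    (h𝒩open : IsOpen 𝒩) (h𝒩sub : 𝒩 ⊆ (closure Ω)ᶜ)
    (hUbdd : Bornology.IsBounded (Ω ∪ 𝒩)) :
    0 < sInf {r : ℝ |
      ∃ u : EuclideanSpace ℝ (Fin n) → ℝ,
        ContDiff ℝ 1 u ∧ HasCompactSupport u ∧
        tsupport u ⊆ Ω ∪ 𝒩 ∪ (frontier Ω ∩ closure 𝒩) ∧
        (∫ x in Ω, (u x) ^ 2) ≠ 0 ∧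
        r = ((∫ x in Ω, ‖gradient u x‖ ^ 2) +
              ∫ p in ((Ωᶜ ×ˢ Ωᶜ)ᶜ :
                  Set (EuclideanSpace ℝ (Fin n) × EuclideanSpace ℝ (Fin n))),
                (u p.1 - u p.2) ^ 2 / ‖p.1 - p.2‖ ^ ((n : ℝ) + 2 * s)) /
            (∫ x in Ω, (u x) ^ 2)} := by
  haveI : Nonempty (Fin n) := ⟨⟨0, hn⟩⟩
  obtain ⟨R, hR⟩ := hUbdd.closure.subset_ball (0 : EuclideanSpace ℝ (Fin n))
  have hU : Ω ∪ 𝒩 ∪ (frontier Ω ∩ closure 𝒩) ⊆ Metric.ball 0 R := by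
    refine Set.Subset.trans ?_ hR
    refine Set.union_subset subset_closure ?_
    exact fun x hx => closure_mono Set.subset_union_right hx.2
  have hRpos : 0 < R := by
    obtain ⟨x, hx⟩ := hΩne
    have := hU (Or.inl (Or.inl hx))
    rw [mem_ball_zero_iff] at this
    exact lt_of_le_of_lt (norm_nonneg _) this
  obtain ⟨v, hv⟩ := exists_norm_eq (EuclideanSpace ℝ (Fin n)) (c := 2 * R) (by positivity)
  set A := Metric.ball v R with hA
  have hAn : ∀ y ∈ A, R ≤ ‖y‖ ∧ ‖y‖ ≤ 3 * R := by
    intro y hy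
    rw [hA, mem_ball_iff_norm] at hy
    have e1 := norm_sub_norm_le v y
    have e2 := norm_sub_norm_le y v
    rw [norm_sub_rev] at e1
    constructor <;> linarith
  have hAfin : volume A ≠ ⊤ := measure_ball_lt_top.ne
  have hApos : 0 < volume.real A :=
    ENNReal.toReal_pos (Metric.measure_ball_pos volume v hRpos).ne' hAfin
  set c : ℝ := volume.real A / (4 * R) ^ ((n : ℝ) + 2 * s) with hcdef
  have hc : 0 < c := by positivity
  have hexp : 0 < (n : ℝ) + 2 * s := by have := hs.1; positivity
  refine lt_of_lt_of_le hc (le_csInf ?_ ?_)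
  · obtain ⟨u, h1, h2, h3, h4⟩ := exists_test n Ω hΩne hΩopen
    exact ⟨_, u, h1, h2, fun x hx => Or.inl (Or.inl (h3 hx)), h4, rfl⟩
  rintro r ⟨u, hu, hcs, hsupp, hne, rfl⟩
  have hcont := hu.continuous
  have hpos : 0 < ∫ x in Ω, (u x) ^ 2 :=
    lt_of_le_of_ne (integral_nonneg fun x => sq_nonneg _) (Ne.symm hne)
  rw [le_div_iff₀ hpos]
  have hg : 0 ≤ ∫ x in Ω, ‖gradient u x‖ ^ 2 := integral_nonneg fun x => by positivity
  have hint := energy_integrable n hn s hs Ω hΩopen hΩbdd u hu hcs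
  have hAΩ : ∀ y ∈ A, u y = 0 := by
    intro y hy
    apply image_eq_zero_of_notMem_tsupport
    intro h
    have := hU (hsupp h)
    rw [mem_ball_zero_iff] at this
    linarith [(hAn y hy).1]
  have hsub : Ω ×ˢ A ⊆ (Ωᶜ ×ˢ Ωᶜ)ᶜ := fun p hp h => h.1 hp.1
  have hmono := setIntegral_mono_set hint
    (Filter.Eventually.of_forall fun p => by simp only [Pi.zero_apply]; positivity) hsub.eventuallyLE
  have hmeasP : MeasurableSet (Ω ×ˢ A) := hΩopen.measurableSet.prod measurableSet_ball
  have hsq : IntegrableOn (fun x => u x ^ 2) Ω := by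
    have hsup : HasCompactSupport (fun x => u x ^ 2) :=
      hcs.comp_left (g := fun t : ℝ => t ^ 2) (by simp)
    exact ((by fun_prop : Continuous fun x => u x ^ 2).integrable_of_hasCompactSupport
      hsup).integrableOn
  have hconstA : IntegrableOn (fun _ : EuclideanSpace ℝ (Fin n) =>
      ((4 * R) ^ ((n : ℝ) + 2 * s))⁻¹) A := integrableOn_const hAfin
  have hlow : c * ∫ x in Ω, (u x) ^ 2 ≤ ∫ p in Ω ×ˢ A,
      (u p.1 - u p.2) ^ 2 / ‖p.1 - p.2‖ ^ ((n : ℝ) + 2 * s) := by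
    have heq : c * ∫ x in Ω, (u x) ^ 2 =
        ∫ p in Ω ×ˢ A, u p.1 ^ 2 * ((4 * R) ^ ((n : ℝ) + 2 * s))⁻¹ := by
      rw [Measure.volume_eq_prod, setIntegral_prod_mul (fun x => u x ^ 2)
        (fun _ => ((4 * R) ^ ((n : ℝ) + 2 * s))⁻¹), setIntegral_const, hcdef, smul_eq_mul]
      ring
    rw [heq]
    refine setIntegral_mono_on ?_ (hint.mono_set hsub) hmeasP ?_
    · rw [IntegrableOn, Measure.volume_eq_prod, ← Measure.prod_restrict]
      exact Integrable.mul_prod hsq hconstA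
    · rintro ⟨x, y⟩ ⟨hx, hy⟩
      have hxn : ‖x‖ < R := by
        have := hU (Or.inl (Or.inl hx))
        rwa [mem_ball_zero_iff] at this
      have hyn := hAn y hy
      have hd : ‖x - y‖ ≤ 4 * R := by
        have := norm_sub_le x y
        linarith
      have hd0 : 0 < ‖x - y‖ := by
        have := norm_sub_norm_le y x
        rw [norm_sub_rev] at this
        linarith
      simp only [hAΩ y hy, sub_zero]
      rw [← div_eq_mul_inv]
      gcongr
  linarith
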